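/- arXiv:1811.08518 — 4 statements merged into one kernel-verified Lean document; each statement's English description precedes it below -/
import Mathlib

section
/- Let Σ be the simplicial complex on vertex set {1,2,3,4,5,6} generated by the facets {1,2,3,4}, {1,2,3,5}, {2,3,4,5}, {2,4,5,6}, {3,4,5,6}, and let Υ be its subcomplex generated by {1,2,5}, {1,2,4}, {2,4,6}, {3,4,6}. Then the set Ψ = Σ ∖ Υ of faces of Σ that are not faces of Υ cannot be written as a union of pairwise disjoint rank 2 boolean intervals of the face poset of Σ. -/
open Finset

/-- `pairs` is a family of pairwise disjoint rank `k` boolean intervals whose union is `P`. -/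
def IsBooleanDecomposition {V : Type*} [DecidableEq V] (k : ℕ)
    (pairs : Set (Finset V × Finset V)) (P : Set (Finset V)) : Prop :=
  (∀ p ∈ pairs, p.1 ⊆ p.2 ∧ (p.2 \ p.1).card = k) ∧
  (P = ⋃ p ∈ pairs, ↑(Finset.Icc p.1 p.2)) ∧
  pairs.PairwiseDisjoint (fun p => (↑(Finset.Icc p.1 p.2) : Set (Finset V)))

/-- `P` can be written as a union of pairwise disjoint rank `k` boolean intervals. -/
def BooleanDecomposable {V : Type*} [DecidableEq V] (k : ℕ) (P : Set (Finset V)) : Prop :=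
  ∃ pairs, IsBooleanDecomposition k pairs P

/-- The simplicial complex Σ = ⟨1234, 1235, 2345, 2456, 3456⟩. -/
def SigmaC : Finset (Finset ℕ) :=
  ({1,2,3,4} : Finset ℕ).powerset ∪ ({1,2,3,5} : Finset ℕ).powerset ∪
  ({2,3,4,5} : Finset ℕ).powerset ∪ ({2,4,5,6} : Finset ℕ).powerset ∪
  ({3,4,5,6} : Finset ℕ).powerset

/-- The subcomplex Υ = ⟨125, 124, 246, 346⟩. -/
def UpsilonC : Finset (Finset ℕ) :=
  ({1,2,5} : Finset ℕ).powerset ∪ ({1,2,4} : Finset ℕ).powerset ∪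
  ({2,4,6} : Finset ℕ).powerset ∪ ({3,4,6} : Finset ℕ).powerset

/-- Every element of a boolean decomposable set lies in an interval of the decomposition, whose
endpoints also lie in the set. -/
lemma IsBooleanDecomposition.exists_interval {V : Type*} [DecidableEq V] {k : ℕ}
    {pairs : Set (Finset V × Finset V)} {P : Set (Finset V)}
    (h : IsBooleanDecomposition k pairs P) {s : Finset V} (hs : s ∈ P) :
    ∃ p ∈ pairs, p.1 ∈ P ∧ p.2 ∈ P ∧ (p.2 \ p.1).card = k ∧ p.1 ⊆ s ∧ s ⊆ p.2 := by
  obtain ⟨hk, hP, -⟩ := h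
  have mem : ∀ p ∈ pairs, ∀ t ∈ Finset.Icc p.1 p.2, t ∈ P := by
    intro p hp t ht
    rw [hP]
    exact Set.mem_biUnion hp (Finset.mem_coe.2 ht)
  rw [hP] at hs
  simp only [Set.mem_iUnion, Finset.mem_coe, Finset.mem_Icc] at hs
  obtain ⟨p, hp, hl, hr⟩ := hs
  exact ⟨p, hp, mem p hp _ (Finset.left_mem_Icc.2 (hk p hp).1),
    mem p hp _ (Finset.right_mem_Icc.2 (hk p hp).1), (hk p hp).2, hl, hr⟩

/-- Two intervals of a boolean decomposition with a common element are equal. -/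
lemma IsBooleanDecomposition.eq_of_mem {V : Type*} [DecidableEq V] {k : ℕ}
    {pairs : Set (Finset V × Finset V)} {P : Set (Finset V)}
    (h : IsBooleanDecomposition k pairs P) {p q : Finset V × Finset V} (hp : p ∈ pairs)
    (hq : q ∈ pairs) (s : Finset V) (hsp : s ∈ Finset.Icc p.1 p.2)
    (hsq : s ∈ Finset.Icc q.1 q.2) : p = q :=
  h.2.2.elim hp hq
    (Set.not_disjoint_iff.2 ⟨s, Finset.mem_coe.2 hsp, Finset.mem_coe.2 hsq⟩)

lemma interval_of_mem_256 : ∀ a ∈ SigmaC \ UpsilonC, ∀ b ∈ SigmaC \ UpsilonC,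
    (b \ a).card = 2 → a ⊆ {2,5,6} → {2,5,6} ⊆ b → a = {5,6} ∧ b = {2,4,5,6} := by
  decide +kernel

lemma interval_of_mem_45 : ∀ a ∈ SigmaC \ UpsilonC, ∀ b ∈ SigmaC \ UpsilonC,
    (b \ a).card = 2 → a ⊆ {4,5} → {4,5} ⊆ b →
      a = {4,5} ∧ (b = {2,3,4,5} ∨ {4,5,6} ⊆ b) := by
  decide +kernel

lemma interval_of_mem_3456 : ∀ a ∈ SigmaC \ UpsilonC, ∀ b ∈ SigmaC \ UpsilonC,
    (b \ a).card = 2 → a ⊆ {3,4,5,6} → {3,4,5,6} ⊆ b →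
      b = {3,4,5,6} ∧ (a ⊆ {4,5,6} ∨ a ⊆ {3,4,5}) := by
  decide +kernel

/-- The relative complex Ψ = Σ ∖ Υ cannot be written as a union of pairwise
disjoint rank 2 boolean intervals of the face poset of Σ. -/
theorem psi_not_rank_two_boolean_decomposable :
    ¬ BooleanDecomposable 2 (↑(SigmaC \ UpsilonC) : Set (Finset ℕ)) := by
  rintro ⟨pairs, h⟩
  obtain ⟨⟨a, b⟩, hp, ha, hb, hc, hl, hr⟩ := h.exists_interval
    (s := {2,5,6}) (Finset.mem_coe.2 (by decide +kernel))
  obtain ⟨rfl, rfl⟩ := interval_of_mem_256 a ha b hb hc hl hr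
  obtain ⟨⟨a, b⟩, hq, ha, hb, hc, hl, hr⟩ := h.exists_interval
    (s := {4,5}) (Finset.mem_coe.2 (by decide +kernel))
  obtain ⟨rfl, rfl | hb'⟩ := interval_of_mem_45 a ha b hb hc hl hr
  · obtain ⟨⟨a, b⟩, hu, ha, hb, hc, hl, hr⟩ := h.exists_interval
      (s := {3,4,5,6}) (Finset.mem_coe.2 (by decide +kernel))
    obtain ⟨rfl, ha' | ha'⟩ := interval_of_mem_3456 a ha b hb hc hl hr
    · have e := h.eq_of_mem hp hu {4,5,6} (by decide +kernel)
        (Finset.mem_Icc.2 ⟨ha', show _ ⊆ ({3,4,5,6} : Finset ℕ) by decide⟩)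
      exact absurd (Prod.mk.inj e).2 (by decide)
    · have e := h.eq_of_mem hq hu {3,4,5} (by decide +kernel)
        (Finset.mem_Icc.2 ⟨ha', show _ ⊆ ({3,4,5,6} : Finset ℕ) by decide⟩)
      exact absurd (Prod.mk.inj e).2 (by decide)
  · have e := h.eq_of_mem hp hq {4,5,6} (by decide +kernel)
      (Finset.mem_Icc.2 ⟨show ({4,5} : Finset ℕ) ⊆ _ by decide, hb'⟩)
    exact absurd (Prod.mk.inj e).1 (by decide)
end

section
/- Let Γ be the simplicial complex on the 12-element vertex set {A,B,C,D,E,F,G,H,I,J,K,L} generated by the facets ABCE, BCEF, BCDF, ABCG, BCGH, BCDH, ABEG, BEFG, BFGH, and let Δ be the simplicial complex generated by these nine facets together with the thirty facets ABCJ, ABIJ, BCIJ, BCDI, CDIJ, ABEK, ABIK, BEIK, BEFI, EFIK, ABGL, ABIL, BGIL, BGHI, GHIL, CDFK, CDJK, CFJK, CEFJ, EFJK, CDHL, CDJL, CHJL, CGHJ, GHJL, EFGL, EFKL, FGKL, FGHK, GHKL (where a string such as ABCE denotes the set {A,B,C,E}). Then the set Φ = Δ ∖ Γ of faces of Δ that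 are not faces of Γ cannot be written as a union of pairwise disjoint rank 2 boolean intervals of the face poset of Δ. -/
open Finset

/-- The complex generated by a list of faces: all subsets of the members of `L`. -/
def genL {V : Type*} [DecidableEq V] (L : List (Finset V)) : Finset (Finset V) :=
  L.toFinset.biUnion Finset.powerset

/-- The facets of Γ, with vertices A,…,L encoded as 0,…,11:
ABCE, BCEF, BCDF, ABCG, BCGH, BCDH, ABEG, BEFG, BFGH. -/
def GammaFacets : List (Finset ℕ) :=
  [{0,1,2,4}, {1,2,4,5}, {1,2,3,5}, {0,1,2,6}, {1,2,6,7}, {1,2,3,7},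
   {0,1,4,6}, {1,4,5,6}, {1,5,6,7}]

/-- The thirty additional facets of Δ:
ABCJ, ABIJ, BCIJ, BCDI, CDIJ, ABEK, ABIK, BEIK, BEFI, EFIK,
ABGL, ABIL, BGIL, BGHI, GHIL, CDFK, CDJK, CFJK, CEFJ, EFJK,
CDHL, CDJL, CHJL, CGHJ, GHJL, EFGL, EFKL, FGKL, FGHK, GHKL. -/
def DeltaExtraFacets : List (Finset ℕ) :=
  [{0,1,2,9}, {0,1,8,9}, {1,2,8,9}, {1,2,3,8}, {2,3,8,9},
   {0,1,4,10}, {0,1,8,10}, {1,4,8,10}, {1,4,5,8}, {4,5,8,10},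
   {0,1,6,11}, {0,1,8,11}, {1,6,8,11}, {1,6,7,8}, {6,7,8,11},
   {2,3,5,10}, {2,3,9,10}, {2,5,9,10}, {2,4,5,9}, {4,5,9,10},
   {2,3,7,11}, {2,3,9,11}, {2,7,9,11}, {2,6,7,9}, {6,7,9,11},
   {4,5,6,11}, {4,5,10,11}, {5,6,10,11}, {5,6,7,10}, {6,7,10,11}]

/-- The simplicial complex Γ. -/
def GammaC : Finset (Finset ℕ) := genL GammaFacets

/-- The simplicial complex Δ. -/
def DeltaC : Finset (Finset ℕ) := genL (GammaFacets ++ DeltaExtraFacets)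

theorem mem_genL {V : Type*} [DecidableEq V] {L : List (Finset V)} {s : Finset V} :
    s ∈ genL L ↔ ∃ F ∈ L, s ⊆ F := by
  simp [genL]

theorem mem_phi_iff {s : Finset ℕ} :
    s ∈ DeltaC \ GammaC ↔ (∃ F ∈ DeltaExtraFacets, s ⊆ F) ∧ ∀ G ∈ GammaFacets, ¬ s ⊆ G := by
  simp only [DeltaC, GammaC, Finset.mem_sdiff, mem_genL, List.mem_append]
  grind

/-- A finite set of natural numbers as a bit mask. -/
def bitMask (s : Finset ℕ) : ℕ := ∑ i ∈ s, 2 ^ i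

theorem testBit_bitMask (s : Finset ℕ) (i : ℕ) : (bitMask s).testBit i = true ↔ i ∈ s := by
  rw [← Nat.mem_bitIndices, ← List.mem_toFinset, bitMask, toFinset_bitIndices_sum_two_pow]

theorem bitMask_injective : Function.Injective bitMask := fun s t h => by
  ext i
  rw [← testBit_bitMask, h, testBit_bitMask]

theorem bitMask_inter (s t : Finset ℕ) : bitMask (s ∩ t) = bitMask s &&& bitMask t :=
  Nat.eq_of_testBit_eq fun i => by
    rw [Bool.eq_iff_iff]
    simp [testBit_bitMask]

theorem bitMask_union (s t : Finset ℕ) : bitMask (s ∪ t) = bitMask s ||| bitMask t :=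
  Nat.eq_of_testBit_eq fun i => by
    rw [Bool.eq_iff_iff]
    simp [testBit_bitMask]

/-- Inclusion of bit masks. -/
def maskLE (m n : ℕ) : Bool := (m &&& n).beq m

theorem maskLE_bitMask (s t : Finset ℕ) : maskLE (bitMask s) (bitMask t) = true ↔ s ⊆ t := by
  simp [maskLE, ← bitMask_inter, bitMask_injective.eq_iff]

/-- The mask `m` lies in the interval with endpoints `c`. -/
def maskHits (m : ℕ) (c : ℕ × ℕ) : Bool := maskLE c.1 m && maskLE m c.2

/-- The intervals with endpoints `c` and `d` are equal or disjoint. -/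
def maskCompatible (c d : ℕ × ℕ) : Bool :=
  (c.1.beq d.1 && c.2.beq d.2) || !maskLE (c.1 ||| d.1) (c.2 &&& d.2)

/-- Depth-first refutation of an exact cover problem. Each entry of the stack is a list of
candidates still available; the points to branch on are read off the first argument. -/
def refutesExactCover {ι α : Type*} (hits : ι → α → Bool) (compatible : α → α → Bool) :
    List ι → List (List α) → Bool
  | _, [] => true
  | [], _ :: _ => false
  | x :: xs, c :: stack =>
    refutesExactCover hits compatible xs
      ((c.filter (hits x)).map (fun a => c.filter (compatible a)) ++ stack)

theorem not_subset_of_refutesExactCover {ι α : Type*} {hits : ι → α → Bool}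
    {compatible : α → α → Bool} {S : Set α}
    (hS : ∀ a ∈ S, ∀ b ∈ S, compatible a b = true) {xs : List ι}
    (hxs : ∀ x ∈ xs, ∃ a ∈ S, hits x a = true) {stack : List (List α)}
    (h : refutesExactCover hits compatible xs stack = true) :
    ∀ c ∈ stack, ∃ a ∈ S, a ∉ c := by
  induction xs generalizing stack with
  | nil => cases stack <;> simp_all [refutesExactCover]
  | cons x xs ih =>
    cases stack with
    | nil => simp
    | cons c stack =>
      have key := ih (fun y hy => hxs y (List.mem_cons_of_mem _ hy)) h
      intro d hd
      rcases List.mem_cons.1 hd with rfl | hd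
      · obtain ⟨a, haS, ha⟩ := hxs x List.mem_cons_self
        by_cases had : a ∈ d
        · obtain ⟨b, hbS, hb⟩ := key (d.filter (compatible a)) (List.mem_append_left _
            (List.mem_map.2 ⟨a, List.mem_filter.2 ⟨had, ha⟩, rfl⟩))
          exact ⟨b, hbS, fun hbd => hb (List.mem_filter.2 ⟨hbd, hS a haS b hbS⟩)⟩
        · exact ⟨a, haS, had⟩
      · exact key d (List.mem_append_right _ hd)

/-- The endpoints, as bit masks, of the rank 2 boolean intervals contained in `Δ ∖ Γ`. -/
def phiIntervals : List (ℕ × ℕ) :=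
  [(257, 2307), (257, 771), (257, 1283), (513, 519), (513, 771), (1025, 1043), (1025, 1283),
   (2049, 2307), (2049, 2115), (258, 2307), (258, 450), (258, 270), (258, 771), (258, 1283),
   (258, 306), (258, 2370), (258, 1298), (258, 774), (514, 519), (514, 771), (514, 774),
   (1026, 1043), (1026, 1283), (1026, 1298), (2050, 2307), (2050, 2115), (2050, 2370), (260, 780),
   (260, 270), (260, 774), (516, 780), (516, 2692), (516, 519), (516, 564), (516, 1548),
   (516, 2572), (516, 1572), (516, 708), (516, 774), (1028, 1068), (1028, 1548), (1028, 1572),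
   (2052, 2692), (2052, 2188), (2052, 2572), (264, 780), (264, 270), (520, 780), (520, 1548),
   (520, 2572), (1032, 1068), (1032, 1548), (2056, 2188), (2056, 2572), (272, 1328), (272, 306),
   (272, 1298), (528, 1584), (528, 564), (1040, 1043), (1040, 1584), (1040, 1328), (1040, 3120),
   (1040, 1298), (2064, 2160), (2064, 3120), (288, 1328), (288, 306), (544, 1584), (544, 564),
   (544, 1572), (1056, 1068), (1056, 1584), (1056, 1328), (1056, 1572), (1056, 1248), (1056, 3120),
   (1056, 3168), (2080, 2160), (2080, 3120), (2080, 3168), (320, 450), (320, 2370), (320, 2496),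
   (576, 2752), (576, 708), (1088, 3264), (1088, 1248), (1088, 3168), (2112, 2160), (2112, 3264),
   (2112, 2752), (2112, 2115), (2112, 2370), (2112, 3168), (2112, 2496), (384, 450), (384, 2496),
   (640, 2752), (640, 2692), (640, 708), (1152, 3264), (1152, 1248), (2176, 3264), (2176, 2752),
   (2176, 2692), (2176, 2188), (2176, 2496), (256, 2432), (256, 266), (256, 1296), (256, 274),
   (256, 2368), (256, 386), (256, 1281), (256, 2306), (256, 1312), (256, 304), (256, 290),
   (256, 268), (256, 776), (256, 259), (256, 2305), (256, 322), (256, 448), (256, 262), (256, 769),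
   (256, 770), (256, 772), (256, 1282), (768, 780), (768, 771), (768, 774), (1280, 1328),
   (1280, 1283), (1280, 1298), (2304, 2307), (2304, 2370), (2304, 2496), (512, 1568), (512, 515),
   (512, 1540), (512, 1544), (512, 2624), (512, 580), (512, 644), (512, 524), (512, 2568),
   (512, 2688), (512, 517), (512, 704), (512, 776), (512, 2564), (512, 1552), (512, 532),
   (512, 548), (512, 769), (512, 770), (512, 518), (512, 772), (512, 560), (1536, 1584),
   (1536, 1548), (1536, 1572), (2560, 2752), (2560, 2692), (2560, 2572), (1024, 1036),
   (1024, 1568), (1024, 1027), (1024, 1184), (1024, 1296), (1024, 3104), (1024, 1540),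
   (1024, 1544), (1024, 1060), (1024, 1281), (1024, 1312), (1024, 1042), (1024, 1064),
   (1024, 3136), (1024, 1072), (1024, 3200), (1024, 3088), (1024, 1120), (1024, 1216),
   (1024, 1552), (1024, 1282), (1024, 1041), (3072, 3264), (3072, 3120), (3072, 3168),
   (2048, 2180), (2048, 2432), (2048, 2144), (2048, 2060), (2048, 3104), (2048, 2624),
   (2048, 2113), (2048, 2368), (2048, 2306), (2048, 2240), (2048, 2568), (2048, 2688),
   (2048, 2051), (2048, 2114), (2048, 2128), (2048, 2096), (2048, 2184), (2048, 3136),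
   (2048, 3200), (2048, 3088), (2048, 2564), (2048, 2305)]

/-- The faces on which the exhaustive search branches. -/
def branchFaces : List (Finset ℕ) :=
  [{1,5,8}, {1,7,8}, {1,3,8}, {1,6,8}, {1,2,8}, {6,7,8,11}, {2,3,8,9}, {3,7,11}, {2,3,9,11},
   {2,7,11}, {5,8,10}, {3,5,10}, {5,7,10}, {5,6,10}, {6,7,10,11}, {2,5,10}, {3,7,11}, {2,3,9,10},
   {2,3,9,11}, {2,11}, {4,8}, {1,3,8}, {1,7,8}, {1,2,8}, {6,8}, {2,3,8,9}, {6,7,8,11}, {3,7,11},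
   {2,3,9,11}, {2,7,11}, {4,5,8,10}, {4,8}, {1,7,8}, {5,7,10}, {1,6,8}, {6,7,8,11}, {7,10,11},
   {5,6,10}, {1,3,8}, {2,8}, {1,7,8}, {1,6,8}, {6,7,8,11}, {2,3,8,9}, {3,7,11}, {2,7,11}, {3,9,11}]

theorem bitMask_mem_phiIntervals {s t : Finset ℕ} (hst : s ⊆ t) (hcard : (t \ s).card = 2)
    (hs : s ∈ DeltaC \ GammaC) (ht : t ∈ DeltaC \ GammaC) :
    (bitMask s, bitMask t) ∈ phiIntervals := by
  have H : ∀ F ∈ DeltaExtraFacets, ∀ t ∈ F.powerset, ∀ s ∈ t.powerset, (t \ s).card = 2 →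
      (∀ G ∈ GammaFacets, ¬ s ⊆ G) → (bitMask s, bitMask t) ∈ phiIntervals := by
    decide +kernel
  obtain ⟨⟨F, hF, htF⟩, -⟩ := mem_phi_iff.1 ht
  exact H F hF t (mem_powerset.2 htF) s (mem_powerset.2 hst) hcard (mem_phi_iff.1 hs).2

theorem branchFaces_mem_phi {f : Finset ℕ} (hf : f ∈ branchFaces) : f ∈ DeltaC \ GammaC := by
  have H : ∀ f ∈ branchFaces,
      (∃ F ∈ DeltaExtraFacets, f ⊆ F) ∧ ∀ G ∈ GammaFacets, ¬ f ⊆ G := by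
    decide +kernel
  exact mem_phi_iff.2 (H f hf)

theorem refutesExactCover_phiIntervals :
    refutesExactCover maskHits maskCompatible (branchFaces.map bitMask) [phiIntervals] = true := by
  decide +kernel

/-- The relative complex Φ = Δ ∖ Γ cannot be written as a union of pairwise
disjoint rank 2 boolean intervals of the face poset of Δ. -/
theorem phi_not_rank_two_boolean_decomposable :
    ¬ BooleanDecomposable 2 (↑(DeltaC \ GammaC) : Set (Finset ℕ)) := by
  rintro ⟨pairs, hrank, hunion, hdisj⟩
  have hmem : ∀ p ∈ pairs, ∀ f, p.1 ⊆ f → f ⊆ p.2 → f ∈ DeltaC \ GammaC := by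
    intro p hp f h1 h2
    rw [← Finset.mem_coe, hunion]
    exact Set.mem_biUnion hp (mem_coe.2 (Finset.mem_Icc.2 ⟨h1, h2⟩))
  let S : Set (ℕ × ℕ) := Prod.map bitMask bitMask '' pairs
  have hcompat : ∀ a ∈ S, ∀ b ∈ S, maskCompatible a b = true := by
    rintro _ ⟨p, hp, rfl⟩ _ ⟨q, hq, rfl⟩
    by_cases hpq : p = q
    · simp [maskCompatible, hpq]
    · have hle : ¬ p.1 ∪ q.1 ⊆ p.2 ∩ q.2 := fun hle =>
        Set.disjoint_left.1 (hdisj hp hq hpq)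
          (mem_coe.2 (Finset.mem_Icc.2 ⟨subset_union_left (s₂ := q.1), hle.trans inter_subset_left⟩))
          (mem_coe.2 (Finset.mem_Icc.2 ⟨subset_union_right, hle.trans inter_subset_right⟩))
      rw [← maskLE_bitMask, bitMask_union, bitMask_inter] at hle
      simp [maskCompatible, hle]
  have hcover : ∀ m ∈ branchFaces.map bitMask, ∃ a ∈ S, maskHits m a = true := by
    intro m hm
    obtain ⟨f, hf, rfl⟩ := List.mem_map.1 hm
    have hf' := mem_coe.2 (branchFaces_mem_phi hf)
    rw [hunion] at hf'
    obtain ⟨p, hp, hfp⟩ := Set.mem_iUnion₂.1 hf'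
    obtain ⟨h1, h2⟩ := Finset.mem_Icc.1 (mem_coe.1 hfp)
    exact ⟨_, ⟨p, hp, rfl⟩, by simp [maskHits, maskLE_bitMask, h1, h2]⟩
  obtain ⟨_, ⟨p, hp, rfl⟩, hnot⟩ := not_subset_of_refutesExactCover hcompat hcover
    refutesExactCover_phiIntervals phiIntervals List.mem_cons_self
  obtain ⟨hsub, hcard⟩ := hrank p hp
  exact hnot (bitMask_mem_phiIntervals hsub hcard
    (hmem p hp p.1 Subset.rfl hsub) (hmem p hp p.2 hsub Subset.rfl))
end

section
/- Let Δ be a finite simplicial complex on vertex set V, let W ⊆ V, and let Γ = Δ|_W = {σ ∈ Δ : σ ⊆ W} be an induced subcomplex of Δ. Let Φ = Δ ∖ Γ, suppose the number of faces in Φ is divisible by 2^k, and suppose Φ cannot be written as a union of pairwise disjoint rank k boolean intervals. Let ℓ be the total number of faces of Γ (including the empty face) and let N be a positive integer with N · 2^k > ℓ. Let Ω_N be the simplicial complex on vertex set W ⊔ ((V ∖ W) × {1,…,N}) whose faces are the faces of Γ together with, for each m ∈ {1,…,N}, the images of the faces of Φ under the injection ι_m that fixes W and sends each v ∈ V ∖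 W to (v,m) (i.e., Ω_N is obtained by gluing N copies of Δ together along Γ). Then the face poset of Ω_N cannot be written as a union of pairwise disjoint rank k boolean intervals. -/
open Finset

/-- A (finite) simplicial complex: a nonempty collection of finite sets closed
under taking subsets. -/
def IsComplex {V : Type*} [DecidableEq V] (Δ : Finset (Finset V)) : Prop :=
  Δ.Nonempty ∧ ∀ σ ∈ Δ, ∀ τ, τ ⊆ σ → τ ∈ Δ

theorem IsBooleanDecomposition.mem_iff {V : Type*} [DecidableEq V] {k : ℕ}
    {pairs : Set (Finset V × Finset V)} {S : Finset (Finset V)}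
    (h : IsBooleanDecomposition k pairs (S : Set (Finset V))) (x : Finset V) :
    x ∈ S ↔ ∃ p ∈ pairs, x ∈ Finset.Icc p.1 p.2 := by
  rw [← Finset.mem_coe, h.2.1]
  simp only [Set.mem_iUnion, Finset.mem_coe, exists_prop]

theorem IsBooleanDecomposition.two_pow_dvd_card {V : Type*} [DecidableEq V] {k : ℕ}
    {pairs : Set (Finset V × Finset V)} {S : Finset (Finset V)}
    (h : IsBooleanDecomposition k pairs (S : Set (Finset V))) : 2 ^ k ∣ S.card := by
  have hmem := h.mem_iff
  obtain ⟨hk, hS, hd⟩ := h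
  have hsub : ∀ p ∈ pairs, Finset.Icc p.1 p.2 ⊆ S := fun p hp x hx => (hmem x).2 ⟨p, hp, hx⟩
  have hfin : pairs.Finite := (S ×ˢ S).finite_toSet.subset fun p hp => by
    have hle := (hk p hp).1
    rw [Finset.mem_coe, Finset.mem_product]
    exact ⟨hsub p hp (Finset.left_mem_Icc.2 hle), hsub p hp (Finset.right_mem_Icc.2 hle)⟩
  lift pairs to Finset (Finset V × Finset V) using hfin
  have hSF : S = pairs.biUnion fun p => Finset.Icc p.1 p.2 := by
    rw [← Finset.coe_inj, hS, Finset.coe_biUnion]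
  rw [hSF, Finset.card_biUnion fun p hp q hq hpq => Finset.disjoint_coe.1 (hd hp hq hpq)]
  refine Finset.dvd_sum fun p hp => ?_
  obtain ⟨hle, hc⟩ := hk p hp
  rw [Finset.card_Icc_finset hle, ← Finset.card_sdiff_of_subset hle, hc]

theorem BooleanDecomposable.of_image {V V' : Type*} [DecidableEq V] [DecidableEq V'] {k : ℕ}
    {f : V → V'} (hf : Function.Injective f) {S : Finset (Finset V)}
    (h : BooleanDecomposable k (↑(S.image (Finset.image f)) : Set (Finset V'))) :
    BooleanDecomposable k (↑S : Set (Finset V)) := by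
  obtain ⟨pairs, h⟩ := h
  have hmem := h.mem_iff
  obtain ⟨hk, -, hd⟩ := h
  have hIcc : ∀ s t u : Finset V,
      u.image f ∈ Finset.Icc (s.image f) (t.image f) ↔ u ∈ Finset.Icc s t := fun s t u => by
    simp only [Finset.mem_Icc, Finset.image_subset_image_iff hf]
  refine ⟨{p | (p.1.image f, p.2.image f) ∈ pairs}, fun p hp => ?_, ?_, ?_⟩
  · have := hk _ hp
    rwa [Finset.image_subset_image_iff hf, ← Finset.image_sdiff _ _ hf,
      Finset.card_image_of_injective _ hf] at this
  · ext u
    simp only [Set.mem_iUnion, Finset.mem_coe, Set.mem_ofPred_eq, exists_prop]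
    rw [← (Finset.image_injective hf).mem_finset_image (s := S), hmem]
    constructor
    · rintro ⟨⟨a, b⟩, hp, hu⟩
      have hle := (hk _ hp).1
      have hb := (hmem b).2 ⟨_, hp, Finset.right_mem_Icc.2 hle⟩
      have ha := (hmem a).2 ⟨_, hp, Finset.left_mem_Icc.2 hle⟩
      obtain ⟨t, -, rfl⟩ := Finset.mem_image.1 hb
      obtain ⟨s, -, rfl⟩ := Finset.mem_image.1 ha
      exact ⟨(s, t), hp, (hIcc s t u).1 hu⟩
    · rintro ⟨p, hp, hu⟩
      exact ⟨_, hp, (hIcc _ _ _).2 hu⟩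
  · intro p hp q hq hpq
    have hne : (p.1.image f, p.2.image f) ≠ (q.1.image f, q.2.image f) := fun he => hpq <| by
      rw [Prod.mk.injEq, (Finset.image_injective hf).eq_iff,
        (Finset.image_injective hf).eq_iff] at he
      exact Prod.ext he.1 he.2
    have hdis := Finset.disjoint_coe.1 (hd hp hq hne)
    refine Finset.disjoint_coe.2 (Finset.disjoint_left.2 fun u hup huq => ?_)
    exact Finset.disjoint_left.1 hdis ((hIcc _ _ _).2 hup) ((hIcc _ _ _).2 huq)

/-- Gluing `N` copies of `Δ` along the induced subcomplex `Γ = Δ|_W`: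
if `Γ` is an induced subcomplex of `Δ`, `Φ = Δ ∖ Γ` has `2 ^ k ∣ |Φ|` faces and is not
rank `k` boolean decomposable, and `N · 2 ^ k > |Γ|`, then the complex `Ω` obtained by
gluing `N` copies of `Δ` together along `Γ` is not rank `k` boolean decomposable. -/
theorem glued_complex_not_boolean_decomposable
    {V : Type*} [DecidableEq V] (Δ : Finset (Finset V)) (W : Finset V)
    (hΔ : IsComplex Δ) (k N : ℕ)
    (Γ : Finset (Finset V)) (hΓ : Γ = Δ.filter (fun σ => σ ⊆ W))
    (Φ : Finset (Finset V)) (hΦ : Φ = Δ \ Γ)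
    (hcard : 2 ^ k ∣ Φ.card)
    (hΦnd : ¬ BooleanDecomposable k (↑Φ : Set (Finset V)))
    (hN : Γ.card < N * 2 ^ k) (hN1 : 1 ≤ N)
    (ι : ℕ → V → V ⊕ (V × ℕ))
    (hι : ∀ m v, ι m v = if v ∈ W then Sum.inl v else Sum.inr (v, m))
    (Ω : Finset (Finset (V ⊕ (V × ℕ))))
    (hΩ : Ω = Γ.image (Finset.image (ι 1)) ∪
      (Finset.Icc 1 N).biUnion (fun m => Φ.image (Finset.image (ι m)))) :
    ¬ BooleanDecomposable k (↑Ω : Set (Finset (V ⊕ (V × ℕ)))) := by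
  classical
  rintro ⟨pairs, hP⟩
  have hmemP := hP.mem_iff
  obtain ⟨hk, -, hd⟩ := hP
  have hinj : ∀ m, Function.Injective (ι m) := fun m a b hab => by
    rw [hι, hι] at hab
    split_ifs at hab <;> simp_all
  have hΓmem : ∀ s, s ∈ Γ ↔ s ∈ Δ ∧ s ⊆ W := fun s => by rw [hΓ, Finset.mem_filter]
  have hΦmem : ∀ s, s ∈ Φ ↔ s ∈ Δ ∧ ¬ s ⊆ W := fun s => by
    rw [hΦ, Finset.mem_sdiff, hΓmem]; tauto
  have himgW : ∀ (m : ℕ) (s : Finset V), s ⊆ W → s.image (ι m) = s.image (ι 1) := fun m s hs =>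
    Finset.image_congr fun v hv => by simp only [hι, if_pos (hs hv)]
  have hinr : ∀ (m : ℕ) (s : Finset V) (v : V) (n : ℕ), (Sum.inr (v, n) : V ⊕ (V × ℕ)) ∈ s.image (ι m) ↔
      v ∈ s ∧ v ∉ W ∧ n = m := fun m s v n => by
    rw [Finset.mem_image]
    constructor
    · rintro ⟨a, ha, he⟩
      rw [hι] at he
      split_ifs at he with hW
      simp only [Sum.inr.injEq, Prod.mk.injEq] at he
      obtain ⟨rfl, rfl⟩ := he
      exact ⟨ha, hW, rfl⟩
    · rintro ⟨hv, hW, rfl⟩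
      exact ⟨v, hv, by rw [hι, if_neg hW]⟩
  set Γ' := Γ.image (Finset.image (ι 1))
  let Φ' : ℕ → Finset (Finset (V ⊕ (V × ℕ))) := fun m => Φ.image (Finset.image (ι m))
  have hΦ'inr : ∀ m, ∀ x ∈ Φ' m, ∃ v, (Sum.inr (v, m) : V ⊕ (V × ℕ)) ∈ x := fun m x hx => by
    obtain ⟨s, hs, rfl⟩ := Finset.mem_image.1 hx
    obtain ⟨v, hv, hW⟩ := Finset.not_subset.1 ((hΦmem s).1 hs).2
    exact ⟨v, (hinr m s v m).2 ⟨hv, hW, rfl⟩⟩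
  have hΦ'eq : ∀ m, ∀ x ∈ Φ' m, ∀ v n, (Sum.inr (v, n) : V ⊕ (V × ℕ)) ∈ x → n = m := by
    intro m x hx v n hv
    obtain ⟨s, hs, rfl⟩ := Finset.mem_image.1 hx
    exact ((hinr m s v n).1 hv).2.2
  have hΓ'inr : ∀ x ∈ Γ', ∀ v n, (Sum.inr (v, n) : V ⊕ (V × ℕ)) ∉ x := fun x hx v n hv => by
    obtain ⟨s, hs, rfl⟩ := Finset.mem_image.1 hx
    obtain ⟨hvs, hvW, -⟩ := (hinr 1 s v n).1 hv
    exact hvW (((hΓmem s).1 hs).2 hvs)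
  have hdown : ∀ m, ∀ y ∈ Φ' m, ∀ x ⊆ y, x ∈ Γ' ∪ Φ' m := fun m y hy x hxy => by
    obtain ⟨t, ht, rfl⟩ := Finset.mem_image.1 hy
    obtain ⟨s, hst, rfl⟩ := Finset.subset_image_iff.1 hxy
    have hsΔ := hΔ.2 t ((hΦmem t).1 ht).1 s hst
    by_cases hsW : s ⊆ W
    · rw [himgW m s hsW]
      exact Finset.mem_union_left _ (Finset.mem_image_of_mem _ ((hΓmem s).2 ⟨hsΔ, hsW⟩))
    · exact Finset.mem_union_right _ (Finset.mem_image_of_mem _ ((hΦmem s).2 ⟨hsΔ, hsW⟩))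
  -- the union of the intervals of the decomposition whose top lies in the `m`-th copy of `Φ`
  let A : ℕ → Finset (Finset (V ⊕ (V × ℕ))) := fun m =>
    Ω.filter fun x => ∃ p ∈ pairs, p.2 ∈ Φ' m ∧ x ∈ Finset.Icc p.1 p.2
  have hAdec : ∀ m, IsBooleanDecomposition k {p ∈ pairs | p.2 ∈ Φ' m}
      (A m : Set (Finset (V ⊕ (V × ℕ)))) := fun m => by
    refine ⟨fun p hp => hk p hp.1, ?_, hd.subset fun p hp => hp.1⟩
    ext x
    simp only [A, Finset.coe_filter, Set.mem_ofPred_eq, Set.mem_iUnion, Finset.mem_coe,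
      exists_prop, and_assoc, hmemP x]
    exact ⟨fun h => h.2, fun h => ⟨h.imp fun p hp => ⟨hp.1, hp.2.2⟩, h⟩⟩
  have hAsub : ∀ m, A m ⊆ Γ' ∪ Φ' m := fun m x hx => by
    obtain ⟨-, p, -, hp2, hxp⟩ := Finset.mem_filter.1 hx
    exact hdown m _ hp2 x (Finset.mem_Icc.1 hxp).2
  have hΦA : ∀ m ∈ Finset.Icc 1 N, Φ' m ⊆ A m := fun m hm x hx => by
    have hxΩ : x ∈ Ω := by
      rw [hΩ]
      exact Finset.mem_union_right _ (Finset.mem_biUnion.2 ⟨m, hm, hx⟩)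
    obtain ⟨p, hp, hxp⟩ := (hmemP x).1 hxΩ
    refine Finset.mem_filter.2 ⟨hxΩ, p, hp, ?_, hxp⟩
    have hp2 := (hmemP p.2).2 ⟨p, hp, Finset.right_mem_Icc.2 (hk p hp).1⟩
    obtain ⟨v, hv⟩ := hΦ'inr m x hx
    have hv2 := (Finset.mem_Icc.1 hxp).2 hv
    rw [hΩ] at hp2
    rcases Finset.mem_union.1 hp2 with hp2 | hp2
    · exact absurd hv2 (hΓ'inr _ hp2 v m)
    · obtain ⟨n, -, hn⟩ := Finset.mem_biUnion.1 hp2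
      rwa [hΦ'eq n _ hn v m hv2]
  have hge : ∀ m ∈ Finset.Icc 1 N, 2 ^ k ≤ (A m \ Φ' m).card := fun m hm => by
    have hΦcard : (Φ' m).card = Φ.card :=
      Finset.card_image_of_injective _ (Finset.image_injective (hinj m))
    have hdvd : 2 ^ k ∣ (A m \ Φ' m).card := by
      rw [Finset.card_sdiff_of_subset (hΦA m hm), hΦcard]
      exact Nat.dvd_sub (hAdec m).two_pow_dvd_card hcard
    refine Nat.le_of_dvd (Nat.pos_of_ne_zero fun h0 => hΦnd ?_) hdvd
    have hAΦ : A m = Φ' m := Finset.Subset.antisymm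
      (Finset.sdiff_eq_empty_iff_subset.1 (Finset.card_eq_zero.1 h0)) (hΦA m hm)
    exact BooleanDecomposable.of_image (hinj m) ⟨_, hAΦ ▸ hAdec m⟩
  have hAdisj : ∀ m n, m ≠ n → Disjoint (A m) (A n) := fun m n hmn =>
    Finset.disjoint_left.2 fun x hxm hxn => hmn <| by
      obtain ⟨-, p, hp, hp2, hxp⟩ := Finset.mem_filter.1 hxm
      obtain ⟨-, q, hq, hq2, hxq⟩ := Finset.mem_filter.1 hxn
      obtain rfl : p = q := by
        by_contra hpq
        exact Finset.disjoint_left.1 (Finset.disjoint_coe.1 (hd hp hq hpq)) hxp hxq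
      obtain ⟨v, hv⟩ := hΦ'inr m _ hp2
      exact hΦ'eq n _ hq2 v m hv
  have hsub : (Finset.Icc 1 N).biUnion (fun m => A m \ Φ' m) ⊆ Γ' :=
    Finset.biUnion_subset.2 fun m _ x hx => by
      obtain ⟨hxA, hxΦ⟩ := Finset.mem_sdiff.1 hx
      exact (Finset.mem_union.1 (hAsub m hxA)).resolve_right hxΦ
  have hcount : N * 2 ^ k ≤ Γ.card := calc
    N * 2 ^ k = ∑ _m ∈ Finset.Icc 1 N, 2 ^ k := by simp
    _ ≤ ∑ m ∈ Finset.Icc 1 N, (A m \ Φ' m).card := Finset.sum_le_sum hge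
    _ = ((Finset.Icc 1 N).biUnion fun m => A m \ Φ' m).card :=
      (Finset.card_biUnion fun m _ n _ hmn =>
        (hAdisj m n hmn).mono Finset.sdiff_subset Finset.sdiff_subset).symm
    _ ≤ Γ'.card := Finset.card_le_card hsub
    _ ≤ Γ.card := Finset.card_image_le
  exact absurd hN hcount.not_gt
end

section
/- Let Δ be a d-dimensional stacked simplicial complex. Then the face poset of Δ can be written as a union of pairwise disjoint rank d boolean intervals such that the set of minimal elements of these intervals is a subcomplex of Δ. -/
open Finset

/-- `L = [F_1, …, F_j]` is a stacked shelling of a pure `d`-dimensional complex: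
the `F_l` are distinct faces of cardinality `d + 1` and, for each `1 ≤ i ≤ j - 1`,
`⟨F_1, …, F_i⟩ ∩ ⟨F_{i+1}⟩` is the powerset of some `d`-element subset of `F_{i+1}`. -/
def IsStackedShelling {V : Type*} [DecidableEq V] (d : ℕ) (L : List (Finset V)) : Prop :=
  L ≠ [] ∧ L.Nodup ∧ (∀ F ∈ L, F.card = d + 1) ∧
  ∀ i : Fin L.length, 0 < i.1 →
    ∃ R ⊆ L.get i, R.card = d ∧ genL (L.take i.1) ∩ (L.get i).powerset = R.powerset

/-- A stacked simplicial complex of dimension `d`: one generated by a stacked shelling. -/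
def IsStacked {V : Type*} [DecidableEq V] (Δ : Finset (Finset V)) (d : ℕ) : Prop :=
  ∃ L : List (Finset V), IsStackedShelling d L ∧ Δ = genL L

theorem IsBooleanDecomposition.insert_Icc {V : Type*} [DecidableEq V] {k : ℕ}
    {pairs : Set (Finset V × Finset V)} {P : Set (Finset V)}
    (h : IsBooleanDecomposition k pairs P) {a b : Finset V} (hab : a ⊆ b)
    (hk : (b \ a).card = k) (hP : Disjoint P (↑(Finset.Icc a b) : Set (Finset V))) :
    IsBooleanDecomposition k (insert (a, b) pairs) (P ∪ ↑(Finset.Icc a b)) := by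
  obtain ⟨hrank, hunion, hdisj⟩ := h
  refine ⟨?_, ?_, ?_⟩
  · rintro p (rfl | hp)
    · exact ⟨hab, hk⟩
    · exact hrank p hp
  · rw [Set.biUnion_insert, ← hunion, Set.union_comm]
  · refine hdisj.insert fun q hq _ => hP.symm.mono_right ?_
    rw [hunion]
    exact Set.subset_biUnion_of_mem (u := fun p : Finset V × Finset V =>
      (↑(Finset.Icc p.1 p.2) : Set (Finset V))) hq

theorem isBooleanDecomposition_singleton {V : Type*} [DecidableEq V] {a b : Finset V}
    (hab : a ⊆ b) :
    IsBooleanDecomposition (b \ a).card {(a, b)} (↑(Finset.Icc a b) : Set (Finset V)) := by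
  refine ⟨?_, by simp, Set.pairwiseDisjoint_singleton _ _⟩
  rintro p rfl
  exact ⟨hab, rfl⟩

/-- A set of size `d + 1` is obtained by adding one vertex to any of its `d`-element subsets. -/
theorem exists_notMem_eq_insert_of_card {V : Type*} [DecidableEq V] {d : ℕ} {F R : Finset V}
    (hRF : R ⊆ F) (hR : R.card = d) (hF : F.card = d + 1) : ∃ v ∉ R, F = insert v R := by
  obtain ⟨v, hv⟩ := Finset.card_eq_one.mp
    (show (F \ R).card = 1 by rw [Finset.card_sdiff_of_subset hRF]; omega)
  have hvF : v ∈ F \ R := by simp [hv]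
  refine ⟨v, (Finset.mem_sdiff.mp hvF).2, ?_⟩
  rw [Finset.insert_eq, ← hv, Finset.sdiff_union_of_subset hRF]

theorem coe_powerset_insert_eq_union_Icc {V : Type*} [DecidableEq V] (v : V) (R : Finset V) :
    (↑(insert v R).powerset : Set (Finset V)) =
      ↑R.powerset ∪ ↑(Finset.Icc {v} (insert v R)) := by
  ext τ
  by_cases hv : v ∈ τ
  · simp only [Finset.mem_coe, Set.mem_union, Finset.mem_powerset, Finset.mem_Icc,
      Finset.singleton_subset_iff, hv, true_and, iff_or_self]
    exact fun h => h.trans (Finset.subset_insert v R)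
  · simp only [Finset.mem_coe, Set.mem_union, Finset.mem_powerset, Finset.mem_Icc,
      Finset.singleton_subset_iff, hv, false_and, or_false,
      Finset.subset_insert_iff_of_notMem hv]

theorem genL_append_singleton {V : Type*} [DecidableEq V] (L : List (Finset V)) (F : Finset V) :
    genL (L ++ [F]) = genL L ∪ F.powerset := by
  ext τ
  simp [genL, or_comm]

/-- Every nonempty initial segment of a stacked shelling decomposes into boolean intervals whose
minimal elements have at most one vertex. -/
theorem IsStackedShelling.exists_decomposition_take {V : Type*} [DecidableEq V] {d : ℕ}
    {L : List (Finset V)} (hL : IsStackedShelling d L) (n : ℕ) (hn : n < L.length) :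
    ∃ pairs : Set (Finset V × Finset V),
      IsBooleanDecomposition d pairs (↑(genL (L.take (n + 1))) : Set (Finset V)) ∧
      ∀ p ∈ pairs, p.1.card ≤ 1 := by
  obtain ⟨-, -, hcard, hstep⟩ := hL
  induction n with
  | zero =>
    have hF := hcard _ (L.getElem_mem hn)
    obtain ⟨R, hRF, hR⟩ := Finset.exists_subset_card_eq (show d ≤ (L[0]).card by omega)
    obtain ⟨v, hvR, hFv⟩ := exists_notMem_eq_insert_of_card hRF hR hF
    have hbase := isBooleanDecomposition_singleton (Finset.empty_subset R)
    rw [Finset.sdiff_empty, hR] at hbase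
    have hIcc : Finset.Icc ∅ R = R.powerset := by ext; simp
    have hdec := hbase.insert_Icc (a := {v}) (b := insert v R) (by simp)
      (by rw [Finset.insert_sdiff_of_mem _ (by simp), Finset.sdiff_singleton_eq_erase,
            Finset.erase_eq_of_notMem hvR, hR])
      (by
        rw [Finset.disjoint_coe, hIcc, Finset.disjoint_left]
        intro τ hτ hτ'
        simp only [Finset.mem_powerset, Finset.mem_Icc,
          Finset.singleton_subset_iff] at hτ hτ'
        exact hvR (hτ hτ'.1))
    refine ⟨{({v}, insert v R), (∅, R)}, ?_, ?_⟩
    · convert hdec using 1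
      rw [hIcc, ← coe_powerset_insert_eq_union_Icc, ← hFv,
        List.take_succ_eq_append_getElem hn, List.take_zero, genL_append_singleton]
      simp [genL]
    · simp
  | succ n ih =>
    obtain ⟨pairs, hpairs, hmin⟩ := ih (by omega)
    have hF := hcard _ (L.getElem_mem hn)
    obtain ⟨R, hRF, hR, hint⟩ := hstep ⟨n + 1, hn⟩ n.succ_pos
    simp only [List.get_eq_getElem] at hRF hint
    obtain ⟨v, hvR, hFv⟩ := exists_notMem_eq_insert_of_card hRF hR hF
    have hRgen : R.powerset ⊆ genL (L.take (n + 1)) := hint ▸ Finset.inter_subset_left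
    have hdec := hpairs.insert_Icc (a := {v}) (b := insert v R) (by simp)
      (by rw [Finset.insert_sdiff_of_mem _ (by simp), Finset.sdiff_singleton_eq_erase,
            Finset.erase_eq_of_notMem hvR, hR])
      (by
        rw [Finset.disjoint_coe, Finset.disjoint_left]
        intro τ hτ hτ'
        simp only [Finset.mem_Icc, Finset.singleton_subset_iff] at hτ'
        have hτR : τ ∈ R.powerset :=
          hint ▸ Finset.mem_inter.mpr ⟨hτ, Finset.mem_powerset.mpr (hFv ▸ hτ'.2)⟩
        exact hvR (Finset.mem_powerset.mp hτR hτ'.1))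
    refine ⟨insert ({v}, insert v R) pairs, ?_, ?_⟩
    · convert hdec using 1
      rw [List.take_succ_eq_append_getElem hn, genL_append_singleton, Finset.coe_union, hFv,
        coe_powerset_insert_eq_union_Icc, ← Set.union_assoc,
        Set.union_eq_left.mpr (Finset.coe_subset.mpr hRgen)]
    · rintro p (rfl | hp)
      · simp
      · exact hmin p hp

/-- A `d`-dimensional stacked complex can be written as a union of pairwise disjoint
rank `d` boolean intervals whose minimal elements together form a subcomplex of `Δ`. -/
theorem stacked_rank_dim_boolean_decomposition
    {V : Type*} [DecidableEq V] (Δ : Finset (Finset V)) (d : ℕ) (h : IsStacked Δ d) :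
    ∃ pairs : Set (Finset V × Finset V),
      IsBooleanDecomposition d pairs (↑Δ : Set (Finset V)) ∧
      ∀ p ∈ pairs, ∀ τ, τ ⊆ p.1 → ∃ q ∈ pairs, q.1 = τ := by
  obtain ⟨L, hL, rfl⟩ := h
  have hpos : 0 < L.length := List.length_pos_of_ne_nil hL.1
  obtain ⟨pairs, hpairs, hmin⟩ := hL.exists_decomposition_take (L.length - 1) (by omega)
  rw [Nat.sub_add_cancel hpos, List.take_length] at hpairs
  refine ⟨pairs, hpairs, fun p hp τ hτ => ?_⟩
  rcases τ.eq_empty_or_nonempty with rfl | hne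
  · have hempty : (∅ : Finset V) ∈ (↑(genL L) : Set (Finset V)) := by
      simpa [genL] using List.exists_mem_of_ne_nil L hL.1
    rw [hpairs.2.1] at hempty
    obtain ⟨q, hq, hmem⟩ := Set.mem_iUnion₂.mp hempty
    exact ⟨q, hq, Finset.subset_empty.mp (Finset.mem_Icc.mp (Finset.mem_coe.mp hmem)).1⟩
  · exact ⟨p, hp, (Finset.eq_of_subset_of_card_le hτ
      ((hmin p hp).trans hne.card_pos)).symm⟩
end
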